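/- For all real numbers I > 0, J > 0 and every integer n ≥ 1, the minimum over (q₁, …, q_n) ∈ (0,1)^n of I/(q₁⋯q_n) + J/((1−q₁)⋯(1−q_n)) equals (I^{1/(n+1)} + J^{1/(n+1)})^{n+1}, attained when every q_j = I^{1/(n+1)}/(I^{1/(n+1)} + J^{1/(n+1)}); that is, (I^{1/(n+1)} + J^{1/(n+1)})^{n+1} is the least element of the set {I/(q₁⋯q_n) + J/((1−q₁)⋯(1−q_n)) : q₁, …, q_n ∈ (0,1)}. -/

import Mathlib

theorem one_add_sum_one_sub_inv_le_prod {ι : Type*} (s : Finset ι) (y : ι → ℝ)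
    (hy : ∀ i ∈ s, 0 < y i) : 1 + ∑ i ∈ s, (1 - (y i)⁻¹) ≤ ∏ i ∈ s, y i := by
  calc 1 + ∑ i ∈ s, (1 - (y i)⁻¹) ≤ 1 + ∑ i ∈ s, Real.log (y i) := by
        gcongr with i hi
        exact Real.one_sub_inv_le_log_of_pos (hy i hi)
    _ ≤ Real.exp (∑ i ∈ s, Real.log (y i)) := by
        rw [add_comm]; exact Real.add_one_le_exp _
    _ = ∏ i ∈ s, y i := by
        rw [Real.exp_sum]
        exact Finset.prod_congr rfl fun i hi => Real.exp_log (hy i hi)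

theorem pow_mul_add_sum_le_pow_succ_div_prod {n : ℕ} {a c : ℝ} (ha : 0 < a) (hc : 0 < c)
    (q : Fin n → ℝ) (hq : ∀ j, 0 < q j) :
    c ^ n * (a + ∑ j, (a - c * q j)) ≤ a ^ (n + 1) / ∏ j, q j := by
  have h := one_add_sum_one_sub_inv_le_prod Finset.univ (fun j => a / (c * q j))
    fun j _ => div_pos ha (mul_pos hc (hq j))
  have hprod : ∏ j, a / (c * q j) = a ^ n / (c ^ n * ∏ j, q j) := by
    simp [Finset.prod_div_distrib, Finset.prod_mul_distrib]
  have hsum : a + ∑ j, (a - c * q j) = a * (1 + ∑ j, (1 - (a / (c * q j))⁻¹)) := by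
    rw [mul_add, mul_one, Finset.mul_sum]
    congr 1
    refine Finset.sum_congr rfl fun j _ => ?_
    rw [inv_div, mul_sub, mul_one, mul_div_cancel₀ _ ha.ne']
  have hP : 0 < ∏ j, q j := Finset.prod_pos fun j _ => hq j
  calc c ^ n * (a + ∑ j, (a - c * q j))
      ≤ c ^ n * (a * ∏ j, a / (c * q j)) := by rw [hsum]; gcongr
    _ = a ^ (n + 1) / ∏ j, q j := by rw [hprod]; field_simp; ring

theorem add_pow_succ_le_div_prod_add_div_prod {n : ℕ} {a b : ℝ} (ha : 0 < a) (hb : 0 < b)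
    (q : Fin n → ℝ) (hq : ∀ j, q j ∈ Set.Ioo (0 : ℝ) 1) :
    (a + b) ^ (n + 1) ≤ a ^ (n + 1) / ∏ j, q j + b ^ (n + 1) / ∏ j, (1 - q j) := by
  have h₁ := pow_mul_add_sum_le_pow_succ_div_prod ha (add_pos ha hb) q fun j => (hq j).1
  have h₂ := pow_mul_add_sum_le_pow_succ_div_prod hb (add_pos ha hb) (fun j => 1 - q j)
    fun j => sub_pos.2 (hq j).2
  have h₀ : ∑ j, (a - (a + b) * q j) + ∑ j, (b - (a + b) * (1 - q j)) = 0 := by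
    rw [← Finset.sum_add_distrib]
    exact Finset.sum_eq_zero fun j _ => by ring
  calc (a + b) ^ (n + 1)
      = (a + b) ^ n * (a + ∑ j, (a - (a + b) * q j))
        + (a + b) ^ n * (b + ∑ j, (b - (a + b) * (1 - q j))) := by
        linear_combination -(a + b) ^ n * h₀
    _ ≤ _ := add_le_add h₁ h₂

theorem rpow_one_div_pow_succ {x : ℝ} (hx : 0 ≤ x) (n : ℕ) :
    (x ^ ((1 : ℝ) / (n + 1))) ^ (n + 1) = x := by
  simpa using Real.rpow_inv_natCast_pow hx n.succ_ne_zero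

/-- For all reals `I > 0`, `J > 0` and every integer `n ≥ 1`, the minimum over
`(q₁,…,q_n) ∈ (0,1)ⁿ` of `I/(q₁⋯q_n) + J/((1−q₁)⋯(1−q_n))` equals
`(I^{1/(n+1)} + J^{1/(n+1)})^{n+1}`, attained when every
`q_j = I^{1/(n+1)}/(I^{1/(n+1)} + J^{1/(n+1)})`; that is, this value is the least
element of the set `{I/(q₁⋯q_n) + J/((1−q₁)⋯(1−q_n)) : q₁,…,q_n ∈ (0,1)}`. -/
theorem min_over_qs_of_weighted_sum (I J : ℝ) (hI : 0 < I) (hJ : 0 < J)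
    (n : ℕ) (hn : 1 ≤ n) :
    IsLeast {x : ℝ | ∃ q : Fin n → ℝ, (∀ j, q j ∈ Set.Ioo (0:ℝ) 1) ∧
        x = I / (∏ j, q j) + J / (∏ j, (1 - q j))}
      ((I ^ ((1:ℝ)/(n+1)) + J ^ ((1:ℝ)/(n+1))) ^ (n+1))
    ∧ (I ^ ((1:ℝ)/(n+1)) / (I ^ ((1:ℝ)/(n+1)) + J ^ ((1:ℝ)/(n+1))) ∈ Set.Ioo (0:ℝ) 1
      ∧ I / (∏ _j : Fin n, I ^ ((1:ℝ)/(n+1)) / (I ^ ((1:ℝ)/(n+1)) + J ^ ((1:ℝ)/(n+1))))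
          + J / (∏ _j : Fin n, (1 - I ^ ((1:ℝ)/(n+1)) / (I ^ ((1:ℝ)/(n+1)) + J ^ ((1:ℝ)/(n+1)))))
        = (I ^ ((1:ℝ)/(n+1)) + J ^ ((1:ℝ)/(n+1))) ^ (n+1)) := by
  have ha := Real.rpow_pos_of_pos hI ((1:ℝ)/(n+1))
  have hb := Real.rpow_pos_of_pos hJ ((1:ℝ)/(n+1))
  have hIa := rpow_one_div_pow_succ hI.le n
  have hJb := rpow_one_div_pow_succ hJ.le n
  generalize I ^ ((1:ℝ)/(n+1)) = a at *
  generalize J ^ ((1:ℝ)/(n+1)) = b at *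
  subst hIa hJb
  have hmem : a / (a + b) ∈ Set.Ioo (0:ℝ) 1 :=
    ⟨by positivity, (div_lt_one (by positivity)).2 (by linarith)⟩
  have hval : a ^ (n + 1) / (∏ _j : Fin n, a / (a + b))
      + b ^ (n + 1) / (∏ _j : Fin n, (1 - a / (a + b))) = (a + b) ^ (n + 1) := by
    have hsub : 1 - a / (a + b) = b / (a + b) := by field_simp; ring
    simp only [hsub, Finset.prod_const, Finset.card_univ, Fintype.card_fin, div_pow]
    field_simp
    ring
  refine ⟨⟨⟨fun _ => a / (a + b), fun _ => hmem, hval.symm⟩, ?_⟩, hmem, hval⟩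
  rintro x ⟨q, hq, rfl⟩
  exact add_pow_succ_le_div_prod_add_div_prod ha hb q hq
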